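/- Let E be a real Hilbert space, let I : E → ℝ be continuously Fréchet differentiable with I(0) = 0, and define J : E → ℝ by J(u) = ½‖u‖² − I(u). Define the Nehari set N = { u ∈ E \ {0} : J'(u)(u) = 0 } and Γ = { γ ∈ C([0,1], E) : γ(0) = 0, J(γ(1)) < 0 }. Assume: (J1) there exists r > 0 such that inf_{‖u‖ = r} J(u) > 0 = J(0); (J2) I(t_n u_n)/t_n² → ∞ whenever t_n → ∞ in ℝ and u_n → u ≠ 0 in E; (J3) for all t > 0 and all u ∈ N, ((t²−1)/2) I'(u)(u) − I(tu) + I(u) ≤ 0. Then Γ ≠ ∅, N ≠ ∅, and 0 < inf_{‖u‖=r} J(u) ≤ c, where c := inf_{γ ∈ Γ} sup_{t ∈ [0,1]} J(γ(t)) = inf_{u ∈ N} J(u) = inf_{u ∈ E \ {0}} sup_{t ≥ 0} J(tu). Moreover there exists a Cerami sequence for J at level c, i.e. a sequence (u_n) ⊂ E such that J(u_n) → c and (1 + ‖u_n‖)·‖J'(u_n)‖_{E*} → 0. -/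

import Mathlib

open Filter Topology

lemma ekeland_aux {X : Type*} [MetricSpace X] [CompleteSpace X] (f : X → ℝ)
    (hf : LowerSemicontinuous f) (m : ℝ) (hm : ∀ x, m ≤ f x) (x0 : X) (ε : ℝ) (hε : 0 < ε) :
    ∃ x, f x ≤ f x0 ∧ ∀ y, f x ≤ f y + ε * dist x y := by
  have step : ∀ (n : ℕ) (x : X), ∃ y, f y + ε * dist x y ≤ f x ∧
      ∀ z, f z + ε * dist x z ≤ f x → f y ≤ f z + (1/2)^n := by
    intro n x
    set S : Set ℝ := f '' {z | f z + ε * dist x z ≤ f x} with hS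
    have hne : S.Nonempty := ⟨f x, x, by simp, rfl⟩
    have hb : BddBelow S := ⟨m, by rintro _ ⟨z, _, rfl⟩; exact hm z⟩
    obtain ⟨_, ⟨y, hy, rfl⟩, hlt⟩ := exists_lt_of_csInf_lt hne
      (show sInf S < sInf S + (1/2)^n by have : (0:ℝ) < (1/2)^n := by positivity
                                         linarith)
    refine ⟨y, hy, fun z hz => ?_⟩
    have := csInf_le hb (Set.mem_image_of_mem f hz)
    linarith
  choose g hg1 hg2 using step
  let u : ℕ → X := fun n => Nat.rec x0 (fun k x => g k x) n
  have hu : ∀ n, u (n+1) = g n (u n) := fun n => rfl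
  have hmono : ∀ n k, f (u (n+k)) + ε * dist (u n) (u (n+k)) ≤ f (u n) := by
    intro n k
    induction k with
    | zero => simp
    | succ k ih =>
      have h1 := hg1 (n+k) (u (n+k))
      rw [← hu] at h1
      have h2 := dist_triangle (u n) (u (n+k)) (u (n+k+1))
      have h3 := mul_le_mul_of_nonneg_left h2 hε.le
      rw [← add_assoc]
      linarith
  have hanti : Antitone (fun n => f (u n)) := antitone_nat_of_succ_le (fun n => by
    have := hmono n 1
    have h2 : 0 ≤ ε * dist (u n) (u (n+1)) := by positivity
    linarith)
  have hlim : Tendsto (fun n => f (u n)) atTop (𝓝 (⨅ n, f (u n))) :=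
    tendsto_atTop_ciInf hanti ⟨m, by rintro _ ⟨z, rfl⟩; exact hm _⟩
  set L := ⨅ n, f (u n)
  have hL : ∀ n, L ≤ f (u n) := fun n => hanti.le_of_tendsto hlim n
  have hcau : CauchySeq u := by
    refine cauchySeq_of_le_tendsto_0' (fun n => (f (u n) - L) / ε) ?_ ?_
    · intro n k hnk
      obtain ⟨j, rfl⟩ := Nat.exists_eq_add_of_le hnk
      rw [le_div_iff₀ hε]
      have := hmono n j
      have := hL (n+j)
      linarith
    · have := (hlim.sub_const L).div_const ε
      simpa using this
  obtain ⟨x, hx⟩ := cauchySeq_tendsto_of_complete hcau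
  have hxS : ∀ n, f x + ε * dist (u n) x ≤ f (u n) := by
    intro n
    have hls : LowerSemicontinuous (fun y => f y + ε * dist (u n) y) :=
      hf.add (Continuous.lowerSemicontinuous (by fun_prop))
    have hc : IsClosed {y | f y + ε * dist (u n) y ≤ f (u n)} := hls.isClosed_preimage _
    refine hc.mem_of_tendsto hx ?_
    filter_upwards [eventually_ge_atTop n] with k hk
    obtain ⟨j, rfl⟩ := Nat.exists_eq_add_of_le hk
    exact hmono n j
  refine ⟨x, ?_, ?_⟩
  · have := hxS 0
    have h2 : 0 ≤ ε * dist (u 0) x := by positivity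
    have h3 : u 0 = x0 := rfl
    rw [h3] at this h2
    linarith
  · intro y
    by_contra! hlt
    have hy : ∀ n, f (u (n+1)) ≤ f y + (1/2)^n := by
      intro n
      rw [hu]
      apply hg2
      have h1 := mul_le_mul_of_nonneg_left (dist_triangle (u n) x y) hε.le
      have := hxS n
      linarith
    have hLy : L ≤ f y := by
      have h1 := (tendsto_add_atTop_iff_nat 1).2 hlim
      have h2 : Tendsto (fun n : ℕ => f y + (1/2:ℝ)^n) atTop (𝓝 (f y + 0)) :=
        tendsto_const_nhds.add (tendsto_pow_atTop_nhds_zero_of_lt_one (by norm_num) (by norm_num))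
      simpa using le_of_tendsto_of_tendsto' h1 h2 hy
    have hxL : f x ≤ L := ge_of_tendsto' hlim (fun n => by
      have := hxS n
      have h2 : 0 ≤ ε * dist (u n) x := by positivity
      linarith)
    have h2 : 0 ≤ ε * dist x y := by positivity
    linarith

lemma perturb_aux {E : Type*} [NormedAddCommGroup E] [InnerProductSpace ℝ E]
    (J : E → ℝ) (hJ : ContDiff ℝ 1 J) (γ w : C(unitInterval, E)) (k : ℝ)
    (h : ∀ h : ℝ, 0 < h → h ≤ 1 → (⨆ s, J (γ s)) - k * h ≤ ⨆ s, J (γ s + h • w s)) :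
    ∃ s, J (γ s) = (⨆ s, J (γ s)) ∧ -k ≤ fderiv ℝ J (γ s) (w s) := by
  have hJc := hJ.continuous
  have hbdd : BddAbove (Set.range fun s => J (γ s)) :=
    (isCompact_range (by fun_prop)).bddAbove
  set F := ⨆ s, J (γ s) with hF
  have key : ∀ n : ℕ, ∃ s : unitInterval, ∃ τ : ℝ, 0 ≤ τ ∧ τ ≤ 1/((n:ℝ)+1) ∧
      F - k * (1/((n:ℝ)+1)) ≤ J (γ s + (1/((n:ℝ)+1)) • w s) ∧
      -k ≤ fderiv ℝ J (γ s + τ • w s) (w s) := by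
    intro n
    set a : ℝ := 1/((n:ℝ)+1) with ha
    have hap : 0 < a := by positivity
    obtain ⟨s, -, hs⟩ := isCompact_univ.exists_isMaxOn (Set.univ_nonempty (α := unitInterval))
      (f := fun s => J (γ s + a • w s)) (by fun_prop)
    have hs1 : (⨆ s, J (γ s + a • w s)) ≤ J (γ s + a • w s) :=
      ciSup_le fun t => hs (Set.mem_univ t)
    have hs2 := h a hap (by
      rw [ha, div_le_one (by positivity)]
      have : (0:ℝ) ≤ n := Nat.cast_nonneg n
      linarith)
    have hd : ∀ τ : ℝ, HasDerivAt (fun τ : ℝ => J (γ s + τ • w s))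
        (fderiv ℝ J (γ s + τ • w s) (w s)) τ := by
      intro τ
      have h1 : HasDerivAt (fun τ : ℝ => γ s + τ • w s) (w s) τ := by
        simpa using ((hasDerivAt_id τ).smul_const (w s)).const_add (γ s)
      exact ((hJ.differentiable (by norm_num) _).hasFDerivAt).comp_hasDerivAt τ h1
    obtain ⟨τ, hτ, hτe⟩ := exists_hasDerivAt_eq_slope (fun τ : ℝ => J (γ s + τ • w s)) _ hap
      (fun τ _ => (hd τ).continuousAt.continuousWithinAt) (fun τ _ => hd τ)
    refine ⟨s, τ, hτ.1.le, hτ.2.le, by linarith, ?_⟩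
    rw [hτe, le_div_iff₀ (by linarith)]
    have : J (γ s) ≤ F := le_ciSup hbdd s
    simp only [zero_smul, add_zero]
    linarith
  choose s τ h0 h1 h2 h3 using key
  obtain ⟨s', φ, hφ, hs'⟩ := CompactSpace.tendsto_subseq s
  have ha : Tendsto (fun n => 1/((φ n:ℝ)+1)) atTop (𝓝 0) :=
    tendsto_one_div_add_atTop_nhds_zero_nat.comp hφ.tendsto_atTop
  have hτ : Tendsto (fun n => τ (φ n)) atTop (𝓝 0) :=
    squeeze_zero (fun n => h0 _) (fun n => h1 _) ha
  have hγ : Tendsto (fun n => γ (s (φ n))) atTop (𝓝 (γ s')) :=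
    (γ.continuous.tendsto _).comp hs'
  have hw : Tendsto (fun n => w (s (φ n))) atTop (𝓝 (w s')) :=
    (w.continuous.tendsto _).comp hs'
  have ht1 : Tendsto (fun n => J (γ (s (φ n)) + (1/((φ n:ℝ)+1)) • w (s (φ n)))) atTop
      (𝓝 (J (γ s'))) := by
    have := (hJc.tendsto _).comp (hγ.add (ha.smul hw))
    simpa [Function.comp_def] using this
  have ht2 : Tendsto (fun n => fderiv ℝ J (γ (s (φ n)) + τ (φ n) • w (s (φ n))) (w (s (φ n)))) atTop
      (𝓝 (fderiv ℝ J (γ s') (w s'))) := by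
    have := ((hJ.continuous_fderiv (by norm_num)).tendsto _).comp (hγ.add (hτ.smul hw))
    have h4 := (continuous_fst.clm_apply continuous_snd).tendsto
      (fderiv ℝ J (γ s' + (0:ℝ) • w s'), w s') |>.comp (this.prodMk_nhds hw)
    simpa [Function.comp_def] using h4
  refine ⟨s', le_antisymm (le_ciSup hbdd s') ?_, ge_of_tendsto' ht2 fun n => h3 _⟩
  have h5 : Tendsto (fun n => F - k * (1/((φ n:ℝ)+1))) atTop (𝓝 F) := by
    simpa using (ha.const_mul k).const_sub F
  exact le_of_tendsto_of_tendsto' h5 ht1 fun n => h2 _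

/-- Logarithmic polar coordinates. -/
noncomputable def lpol {E : Type*} [NormedAddCommGroup E] [InnerProductSpace ℝ E] (u : E) : ℝ × E :=
  (Real.log (1 + ‖u‖), (1 + ‖u‖)⁻¹ • u)

/-- Inverse of the logarithmic polar coordinates. -/
noncomputable def lpolInv {E : Type*} [NormedAddCommGroup E] [InnerProductSpace ℝ E]
    (p : ℝ × E) : E := Real.exp p.1 • p.2

section
variable {E : Type*} [NormedAddCommGroup E] [InnerProductSpace ℝ E]

lemma lpolInv_lpol (u : E) : lpolInv (lpol u) = u := by
  have : 0 < 1 + ‖u‖ := by positivity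
  simp only [lpolInv, lpol, Real.exp_log this, smul_smul]
  rw [mul_inv_cancel₀ this.ne', one_smul]

lemma lpol_cont : Continuous (lpol : E → ℝ × E) := by
  have : ∀ u : E, 1 + ‖u‖ ≠ 0 := fun u => by positivity
  unfold lpol
  fun_prop (disch := exact this _)

lemma lpolInv_cont : Continuous (lpolInv : ℝ × E → E) := by
  unfold lpolInv
  fun_prop

lemma lpol_dist (u v : E) (huv : ‖v - u‖ ≤ (1 + ‖u‖) / 2) :
    dist (lpol u) (lpol v) ≤ 2 * (‖v - u‖ / (1 + ‖u‖)) := by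
  have hu : 0 < 1 + ‖u‖ := by positivity
  have hv : 0 < 1 + ‖v‖ := by positivity
  rw [Prod.dist_eq]
  have hn : |‖v‖ - ‖u‖| ≤ ‖v - u‖ := abs_norm_sub_norm_le v u
  have hE2 : dist ((1 + ‖u‖)⁻¹ • u) ((1 + ‖v‖)⁻¹ • v) ≤ 2 * (‖v - u‖ / (1 + ‖u‖)) := by
    have heq : (1 + ‖v‖)⁻¹ • v - (1 + ‖u‖)⁻¹ • u =
        (1 + ‖u‖)⁻¹ • (v - u) + ((1 + ‖v‖)⁻¹ - (1 + ‖u‖)⁻¹) • v := by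
      module
    rw [dist_comm, dist_eq_norm, heq]
    refine (norm_add_le _ _).trans ?_
    rw [norm_smul, norm_smul, two_mul]
    have e1 : ‖(1 + ‖u‖)⁻¹‖ * ‖v - u‖ = ‖v - u‖ / (1 + ‖u‖) := by
      rw [Real.norm_of_nonneg (by positivity)]; field_simp
    have e2 : ‖(1 + ‖v‖)⁻¹ - (1 + ‖u‖)⁻¹‖ * ‖v‖ ≤ ‖v - u‖ / (1 + ‖u‖) := by
      have : (1 + ‖v‖)⁻¹ - (1 + ‖u‖)⁻¹ = (‖u‖ - ‖v‖) / ((1 + ‖v‖) * (1 + ‖u‖)) := by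
        field_simp; ring
      rw [this, norm_div, Real.norm_eq_abs, abs_sub_comm, Real.norm_of_nonneg (by positivity),
        div_mul_eq_mul_div, div_le_div_iff₀ (by positivity) hu]
      have : |‖v‖ - ‖u‖| * ‖v‖ ≤ ‖v-u‖ * (1 + ‖v‖) := by
        gcongr; linarith
      nlinarith
    linarith
  have hlog : ∀ a b : ℝ, 0 < a → 0 < b → Real.log b - Real.log a ≤ (b - a)/a := by
    intro a b ha hb
    rw [← Real.log_div hb.ne' ha.ne']
    have := Real.log_le_sub_one_of_pos (div_pos hb ha)
    have h : b/a - 1 = (b-a)/a := by field_simp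
    linarith
  have hE1 : dist (Real.log (1 + ‖u‖)) (Real.log (1 + ‖v‖)) ≤ 2 * (‖v - u‖ / (1 + ‖u‖)) := by
    rw [Real.dist_eq, abs_le']
    have h1 := hlog _ _ hv hu
    have h2 := hlog _ _ hu hv
    have h3 := abs_le.1 hn
    have h0 := norm_nonneg (v - u)
    constructor
    · refine h1.trans ?_
      rw [← mul_div_assoc, div_le_div_iff₀ hv hu]
      have : (1 + ‖u‖ - (1 + ‖v‖)) * (1 + ‖u‖) ≤ ‖v - u‖ * (1 + ‖u‖) := by
        gcongr; linarith
      have : ‖v - u‖ * (1 + ‖u‖) ≤ ‖v - u‖ * (2 * (1 + ‖v‖)) := by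
        gcongr; linarith
      linarith
    · have : (1 + ‖v‖ - (1 + ‖u‖)) / (1 + ‖u‖) ≤ ‖v - u‖ / (1 + ‖u‖) := by
        gcongr; linarith
      have : 0 ≤ ‖v - u‖ / (1 + ‖u‖) := by positivity
      linarith
  exact max_le hE1 hE2

lemma cerami_aux [CompleteSpace E] (J : E → ℝ) (hJ : ContDiff ℝ 1 J) (e : E) (hJ0 : J 0 ≤ 0)
    (hJe : J e ≤ 0) (c : ℝ) (hc : 0 < c)
    (hcle : ∀ γ : C(unitInterval, E), γ 0 = 0 → γ 1 = e → c ≤ ⨆ s, J (γ s))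
    (ε : ℝ) (hε : 0 < ε) (γ₀ : C(unitInterval, E)) (h00 : γ₀ 0 = 0) (h01 : γ₀ 1 = e)
    (hγ₀ : (⨆ s, J (γ₀ s)) ≤ c + ε) :
    ∃ u, c ≤ J u ∧ J u ≤ c + ε ∧ (1 + ‖u‖) * ‖fderiv ℝ J u‖ ≤ 2 * ε := by
  have hJc := hJ.continuous
  have hinv := lpolInv_cont (E := E)
  have hpol := lpol_cont (E := E)
  let X : Set C(unitInterval, ℝ × E) :=
    {σ | (∀ s, lpol (lpolInv (σ s)) = σ s) ∧ σ 0 = lpol 0 ∧ σ 1 = lpol e}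
  have hX : IsClosed X := by
    have h1 : IsClosed {σ : C(unitInterval, ℝ × E) | ∀ s, lpol (lpolInv (σ s)) = σ s} := by
      rw [Set.ofPred_forall]
      refine isClosed_iInter fun s => isClosed_eq ?_ (by fun_prop)
      exact hpol.comp (hinv.comp (by fun_prop))
    refine h1.inter (IsClosed.inter ?_ ?_)
    · exact isClosed_eq (by fun_prop) continuous_const
    · exact isClosed_eq (by fun_prop) continuous_const
  have : CompleteSpace X := hX.completeSpace_coe
  let lift : C(unitInterval, E) → C(unitInterval, ℝ × E) :=
    fun γ => ⟨fun s => lpol (γ s), hpol.comp γ.continuous⟩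
  let drop : C(unitInterval, ℝ × E) → C(unitInterval, E) :=
    fun σ => ⟨fun s => lpolInv (σ s), hinv.comp σ.continuous⟩
  have hlift : ∀ γ : C(unitInterval, E), γ 0 = 0 → γ 1 = e → lift γ ∈ X := by
    intro γ h0 h1
    refine ⟨fun s => ?_, ?_, ?_⟩
    · simp only [lift, ContinuousMap.coe_mk, lpolInv_lpol]
    · simp only [lift, ContinuousMap.coe_mk, h0]
    · simp only [lift, ContinuousMap.coe_mk, h1]
  let F : X → ℝ := fun σ => ⨆ s, J (lpolInv (σ.1 s))
  have hFc : ∀ σ : X, c ≤ F σ := by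
    intro σ
    refine hcle (drop σ.1) ?_ ?_
    · simp only [drop, ContinuousMap.coe_mk, σ.2.2.1, lpolInv_lpol]
    · simp only [drop, ContinuousMap.coe_mk, σ.2.2.2, lpolInv_lpol]
  have hFl : LowerSemicontinuous F := by
    refine lowerSemicontinuous_ciSup (fun σ => ?_) (fun s => ?_)
    · exact (isCompact_range (hJc.comp (hinv.comp σ.1.continuous))).bddAbove
    · apply Continuous.lowerSemicontinuous
      exact hJc.comp (hinv.comp (by fun_prop))
  have hFlift : ∀ (γ : C(unitInterval, E)) (h : lift γ ∈ X), F ⟨lift γ, h⟩ = ⨆ s, J (γ s) := by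
    intro γ h
    simp only [F, lift, ContinuousMap.coe_mk, lpolInv_lpol]
  obtain ⟨σ, hσ0, hσ⟩ := ekeland_aux F hFl c hFc ⟨lift γ₀, hlift γ₀ h00 h01⟩ ε hε
  rw [hFlift] at hσ0
  set γ : C(unitInterval, E) := drop σ.1 with hγ
  have hγ0 : γ 0 = 0 := by
    simp only [hγ, drop, ContinuousMap.coe_mk, σ.2.2.1, lpolInv_lpol]
  have hγ1 : γ 1 = e := by
    simp only [hγ, drop, ContinuousMap.coe_mk, σ.2.2.2, lpolInv_lpol]
  have hσγ : ∀ s, σ.1 s = lpol (γ s) := fun s => (σ.2.1 s).symm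
  set M := F σ with hM
  have hMγ : M = ⨆ s, J (γ s) := rfl
  have hMc : c ≤ M := hFc σ
  have hMp : 0 < M := hc.trans_le hMc
  have hJM : ∀ s, J (γ s) ≤ M := fun s =>
    le_ciSup (f := fun s => J (γ s)) (isCompact_range (by fun_prop)).bddAbove s
  let G : E → E := fun u => (InnerProductSpace.toDual ℝ E).symm (fderiv ℝ J u)
  have hG : Continuous G :=
    (InnerProductSpace.toDual ℝ E).symm.continuous.comp (hJ.continuous_fderiv (by norm_num))
  have hGn : ∀ u, ‖G u‖ = ‖fderiv ℝ J u‖ := fun u => LinearIsometryEquiv.norm_map _ _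
  have hGd : ∀ u, fderiv ℝ J u (G u) = ‖fderiv ℝ J u‖ ^ 2 := by
    intro u
    rw [← hGn u, ← real_inner_self_eq_norm_sq]
    simp only [G, InnerProductSpace.toDual_symm_apply]
  let A : E → ℝ := fun u => (1 + ‖u‖) * ‖G u‖
  have hA : Continuous A := by fun_prop
  have hAnn : ∀ u, 0 ≤ A u := fun u => by positivity
  have hmaxp : ∀ u, 0 < max (2 * ε) (A u) := fun u => lt_max_of_lt_left (by positivity)
  let κ : E → ℝ := fun u => (max 0 (J u) / M / 2) * (1 + ‖u‖) ^ 2 / max (2 * ε) (A u)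
  have hκ : Continuous κ := by
    refine Continuous.div (by fun_prop) (by fun_prop) fun u => (hmaxp u).ne'
  let w : C(unitInterval, E) := ⟨fun s => -(κ (γ s) • G (γ s)),
    ((hκ.comp γ.continuous).smul (hG.comp γ.continuous)).neg⟩
  have hw : ∀ s, w s = -(κ (γ s) • G (γ s)) := fun s => rfl
  have hw0 : ∀ s, J (γ s) ≤ 0 → w s = 0 := by
    intro s hs
    simp [hw, κ, max_eq_left hs]
  have hwn : ∀ s, ‖w s‖ ≤ (1 + ‖γ s‖) / 2 := by
    intro s
    have hκ0 : 0 ≤ κ (γ s) := by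
      have := (hmaxp (γ s)).le
      positivity
    rw [hw, norm_neg, norm_smul, Real.norm_of_nonneg hκ0]
    have e : κ (γ s) * ‖G (γ s)‖ =
      (max 0 (J (γ s)) / M) * (A (γ s) / max (2 * ε) (A (γ s))) * ((1 + ‖γ s‖) / 2) := by
      simp only [κ, A]
      ring
    rw [e]
    have h1 : max 0 (J (γ s)) / M ≤ 1 := by
      rw [div_le_one hMp]
      exact max_le hMp.le (hJM s)
    have h2 : A (γ s) / max (2 * ε) (A (γ s)) ≤ 1 := by
      rw [div_le_one (hmaxp _)]
      exact le_max_right _ _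
    have h3 : 0 ≤ A (γ s) / max (2 * ε) (A (γ s)) := div_nonneg (hAnn _) (hmaxp _).le
    have h4 := mul_le_one₀ h1 h3 h2
    exact mul_le_of_le_one_left (by positivity) h4
  obtain ⟨s, hs1, hs2⟩ := perturb_aux J hJ γ w ε (by
    intro h hh0 hh1
    let η : C(unitInterval, E) := γ + h • w
    have hη : ∀ s, η s = γ s + h • w s := fun s => rfl
    have hη0 : η 0 = 0 := by
      rw [hη, hw0 0 (by rw [hγ0]; exact hJ0), hγ0]; simp
    have hη1 : η 1 = e := by
      rw [hη, hw0 1 (by rw [hγ1]; exact hJe), hγ1]; simp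
    have hmem := hlift η hη0 hη1
    have h1 := hσ ⟨lift η, hmem⟩
    rw [hFlift] at h1
    have hd : dist σ ⟨lift η, hmem⟩ ≤ h := by
      rw [Subtype.dist_eq, ContinuousMap.dist_le hh0.le]
      intro s
      have hp : 0 < 1 + ‖γ s‖ := by positivity
      have e1 : ‖η s - γ s‖ = h * ‖w s‖ := by
        rw [hη, add_sub_cancel_left, norm_smul, Real.norm_of_nonneg hh0.le]
      have e2 := mul_le_mul_of_nonneg_left (hwn s) hh0.le
      rw [hσγ s]
      refine (lpol_dist (γ s) (η s) ?_).trans ?_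
      · rw [e1]
        have := mul_le_mul_of_nonneg_right hh1 (norm_nonneg (w s))
        have := hwn s
        linarith
      · rw [e1, ← mul_div_assoc, div_le_iff₀ hp]
        linarith
    have h2 := mul_le_mul_of_nonneg_left hd hε.le
    rw [← hMγ]
    change M - ε * h ≤ ⨆ s, J (η s)
    linarith)
  rw [← hMγ] at hs1
  refine ⟨γ s, by linarith, by linarith, ?_⟩
  rw [← hGn]
  change A (γ s) ≤ 2 * ε
  by_contra! hlt
  rw [hw, map_neg, map_smul, hGd, ← hGn, smul_eq_mul] at hs2
  have hAp : 0 < A (γ s) := by linarith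
  have e : κ (γ s) * ‖G (γ s)‖ ^ 2 = A (γ s) / 2 := by
    simp only [κ]
    rw [hs1, max_eq_right hMp.le, max_eq_right hlt.le, div_self hMp.ne']
    rw [div_mul_eq_mul_div, div_eq_iff hAp.ne']
    simp only [A]
    ring
  rw [e] at hs2
  linarith
end

lemma slope_right_aux (f : ℝ → ℝ) (f' x b : ℝ) (hf : HasDerivAt f f' x) (h : f' < 0) (hb : x < b) :
    ∃ y, x < y ∧ y < b ∧ f y < f x := by
  have h1 := (hasDerivAt_iff_tendsto_slope.1 hf).mono_left
    (nhdsWithin_mono x (show Set.Ioi x ⊆ {x}ᶜ from fun y hy => ne_of_gt hy))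
  obtain ⟨y, hy1, hy2⟩ := ((h1.eventually (gt_mem_nhds h)).and (Ioo_mem_nhdsGT hb)).exists
  refine ⟨y, hy2.1, hy2.2, ?_⟩
  rw [slope_def_field, div_lt_iff₀ (by linarith [hy2.1])] at hy1
  linarith

lemma slope_left_aux (f : ℝ → ℝ) (f' x b : ℝ) (hf : HasDerivAt f f' x) (h : 0 < f') (hb : b < x) :
    ∃ y, b < y ∧ y < x ∧ f y < f x := by
  have h1 := (hasDerivAt_iff_tendsto_slope.1 hf).mono_left
    (nhdsWithin_mono x (show Set.Iio x ⊆ {x}ᶜ from fun y hy => ne_of_lt hy))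
  obtain ⟨y, hy1, hy2⟩ := ((h1.eventually (lt_mem_nhds h)).and (Ioo_mem_nhdsLT hb)).exists
  refine ⟨y, hy2.1, hy2.2, ?_⟩
  rw [slope_def_field, lt_div_iff_of_neg (by linarith [hy2.2])] at hy1
  linarith

/-- Abstract critical point theorem (Theorem 5.1 of Bieganowski–Mederski):
under (J1)–(J3), the mountain-pass level `c` coincides with the Nehari level and
there exists a Cerami sequence for `J` at level `c`. -/
theorem abstract_critical_point_theorem
    {E : Type*} [NormedAddCommGroup E] [InnerProductSpace ℝ E] [CompleteSpace E]
    (I : E → ℝ) (hI : ContDiff ℝ 1 I) (hI0 : I 0 = 0)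
    (J : E → ℝ) (hJdef : ∀ u, J u = 1 / 2 * ‖u‖ ^ 2 - I u)
    (Neh : Set E) (hNeh : Neh = {u : E | u ≠ 0 ∧ fderiv ℝ J u u = 0})
    (Γ : Set (ℝ → E))
    (hΓ : Γ = {γ : ℝ → E | ContinuousOn γ (Set.Icc 0 1) ∧ γ 0 = 0 ∧ J (γ 1) < 0})
    (r : ℝ) (hr : 0 < r)
    -- (J1)
    (hJ1 : 0 < sInf {a : ℝ | ∃ u : E, ‖u‖ = r ∧ a = J u})
    -- (J2)
    (hJ2 : ∀ (t : ℕ → ℝ) (un : ℕ → E) (u : E),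
      Tendsto t atTop atTop → Tendsto un atTop (𝓝 u) → u ≠ 0 →
      Tendsto (fun n => I (t n • un n) / t n ^ 2) atTop atTop)
    -- (J3)
    (hJ3 : ∀ t : ℝ, 0 < t → ∀ u ∈ Neh,
      (t ^ 2 - 1) / 2 * fderiv ℝ I u u - I (t • u) + I u ≤ 0) :
    Γ.Nonempty ∧ Neh.Nonempty ∧
    (0 < sInf {a : ℝ | ∃ u : E, ‖u‖ = r ∧ a = J u} ∧
      sInf {a : ℝ | ∃ u : E, ‖u‖ = r ∧ a = J u} ≤
        sInf {a : ℝ | ∃ γ ∈ Γ, a = sSup {b : ℝ | ∃ t ∈ Set.Icc (0:ℝ) 1, b = J (γ t)}}) ∧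
    sInf {a : ℝ | ∃ γ ∈ Γ, a = sSup {b : ℝ | ∃ t ∈ Set.Icc (0:ℝ) 1, b = J (γ t)}}
      = sInf {a : ℝ | ∃ u ∈ Neh, a = J u} ∧
    sInf {a : ℝ | ∃ γ ∈ Γ, a = sSup {b : ℝ | ∃ t ∈ Set.Icc (0:ℝ) 1, b = J (γ t)}}
      = sInf {a : ℝ | ∃ u : E, u ≠ 0 ∧ a = sSup {b : ℝ | ∃ t : ℝ, 0 ≤ t ∧ b = J (t • u)}} ∧
    ∃ un : ℕ → E,
      Tendsto (fun n => J (un n)) atTop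
        (𝓝 (sInf {a : ℝ | ∃ γ ∈ Γ, a = sSup {b : ℝ | ∃ t ∈ Set.Icc (0:ℝ) 1, b = J (γ t)}})) ∧
      Tendsto (fun n => (1 + ‖un n‖) * ‖fderiv ℝ J (un n)‖) atTop (𝓝 0) := by
  have hJfun : J = fun u => 1 / 2 * ‖u‖ ^ 2 - I u := funext hJdef
  have hJ : ContDiff ℝ 1 J := by
    rw [hJfun]
    exact (contDiff_const.mul (contDiff_norm_sq ℝ)).sub hI
  have hJc := hJ.continuous
  have hJ0 : J 0 = 0 := by simp [hJdef, hI0]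
  have hJder : ∀ u, fderiv ℝ J u u = ‖u‖ ^ 2 - fderiv ℝ I u u := by
    intro u
    have h1 : HasFDerivAt J ((1 / 2 : ℝ) • (2 • innerSL ℝ u) - fderiv ℝ I u) u := by
      rw [hJfun]
      exact (((hasStrictFDerivAt_norm_sq u).hasFDerivAt).const_mul (1/2)).sub
        (hI.differentiable (by norm_num) u).hasFDerivAt
    rw [h1.fderiv]
    simp
  set ρ := sInf {a : ℝ | ∃ u : E, ‖u‖ = r ∧ a = J u} with hρ
  have hbddS : BddBelow {a : ℝ | ∃ u : E, ‖u‖ = r ∧ a = J u} := by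
    by_contra hb
    rw [hρ, Real.sInf_of_not_bddBelow hb] at hJ1
    exact lt_irrefl _ hJ1
  have hsph : ∀ u : E, ‖u‖ = r → ρ ≤ J u := fun u hu => csInf_le hbddS ⟨u, hu, rfl⟩
  obtain ⟨u₀, hu₀⟩ : ∃ u : E, ‖u‖ = r := by
    by_contra! hne
    have : {a : ℝ | ∃ u : E, ‖u‖ = r ∧ a = J u} = ∅ := by
      ext a; simp [hne]
    rw [hρ, this, Real.sInf_empty] at hJ1
    exact lt_irrefl _ hJ1
  have hu₀0 : u₀ ≠ 0 := by
    rintro rfl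
    simp at hu₀; linarith
  have hray : ∀ u : E, u ≠ 0 → ρ ≤ J ((r / ‖u‖) • u) := by
    intro u hu
    apply hsph
    have := norm_pos_iff.2 hu
    rw [norm_smul, Real.norm_of_nonneg (by positivity)]
    field_simp
  have hNmem : ∀ u, u ∈ Neh ↔ u ≠ 0 ∧ fderiv ℝ J u u = 0 := fun u => by rw [hNeh]; rfl
  have hN1 : ∀ u ∈ Neh, ∀ t : ℝ, 0 < t → J (t • u) ≤ J u := by
    intro u hu t ht
    have h1 := hJ3 t ht u hu
    have h2 := ((hNmem u).1 hu).2
    rw [hJder] at h2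
    have h3 : fderiv ℝ I u u = ‖u‖ ^ 2 := by linarith
    rw [h3] at h1
    rw [hJdef, hJdef, norm_smul, Real.norm_of_nonneg ht.le, mul_pow]
    linarith
  have hNρ : ∀ u ∈ Neh, ρ ≤ J u := by
    intro u hu
    have h0 := ((hNmem u).1 hu).1
    have := norm_pos_iff.2 h0
    exact (hray u h0).trans (hN1 u hu _ (by positivity))
  have hN2 : ∀ u ∈ Neh, ∀ t : ℝ, 0 ≤ t → J (t • u) ≤ J u := by
    intro u hu t ht
    rcases ht.eq_or_lt with rfl | ht
    · rw [zero_smul, hJ0]; exact hJ1.le.trans (hNρ u hu)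
    · exact hN1 u hu t ht
  have hder : ∀ (u : E) (t : ℝ), HasDerivAt (fun t : ℝ => J (t • u)) (fderiv ℝ J (t • u) u) t := by
    intro u t
    have h1 : HasDerivAt (fun t : ℝ => t • u) u t := by
      simpa using (hasDerivAt_id t).smul_const u
    exact ((hJ.differentiable (by norm_num) _).hasFDerivAt).comp_hasDerivAt t h1
  have hcrit : ∀ (u : E) (t : ℝ), u ≠ 0 → 0 < t → fderiv ℝ J (t • u) u = 0 → t • u ∈ Neh := by
    intro u t hu ht h
    rw [hNmem]
    exact ⟨smul_ne_zero ht.ne' hu, by rw [map_smul, h, smul_zero]⟩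
  have hneg : ∀ u : E, u ≠ 0 → ∃ T : ℝ, 0 < T ∧ ∀ t, T ≤ t → J (t • u) < 0 := by
    intro u hu
    by_contra! hcon
    choose t ht1 ht2 using fun n : ℕ => hcon ((n:ℝ) + 1) (by positivity)
    have htt : Tendsto t atTop atTop :=
      tendsto_atTop_mono (fun n => by linarith [ht1 n]) tendsto_natCast_atTop_atTop
    have h1 := hJ2 t (fun _ => u) u htt tendsto_const_nhds hu
    obtain ⟨n, hn⟩ := (h1.eventually_gt_atTop (1/2 * ‖u‖ ^ 2)).exists
    have htp : 0 < t n := by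
      have := ht1 n
      have h : (0:ℝ) ≤ n := Nat.cast_nonneg n
      linarith
    rw [lt_div_iff₀ (by positivity)] at hn
    have h2 := ht2 n
    rw [hJdef, norm_smul, Real.norm_of_nonneg htp.le, mul_pow] at h2
    linarith
  have hmax : ∀ u : E, u ≠ 0 → ∃ t : ℝ, 0 < t ∧ t • u ∈ Neh := by
    intro u hu
    obtain ⟨T, hT0, hT⟩ := hneg u hu
    have hup := norm_pos_iff.2 hu
    have hTr : r / ‖u‖ < T := by
      by_contra! hle
      have := hT _ hle
      have := hray u hu
      linarith
    have hrp : 0 < r / ‖u‖ := by positivity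
    obtain ⟨m, hm, hmm⟩ := isCompact_Icc.exists_isMaxOn (Set.nonempty_Icc.2 hT0.le)
      (f := fun t : ℝ => J (t • u)) (by fun_prop)
    have h1 : ρ ≤ J (m • u) := (hray u hu).trans (hmm ⟨hrp.le, hTr.le⟩)
    have hm0 : 0 < m := by
      rcases hm.1.eq_or_lt with h | h
      · rw [← h, zero_smul, hJ0] at h1; linarith
      · exact h
    have hmT : m < T := by
      rcases hm.2.eq_or_lt with h | h
      · have := hT m h.ge
        linarith
      · exact h
    exact ⟨m, hm0, hcrit u m hu hm0
      ((hmm.isLocalMax (Icc_mem_nhds hm0 hmT)).hasDerivAt_eq_zero (hder u m))⟩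
  have hA : ∀ (u : E) (a x b : ℝ), u ≠ 0 → 0 ≤ a → a < x → x < b → J (x • u) < J (a • u) →
      J (x • u) < J (b • u) → J (x • u) < ρ → False := by
    intro u a x b hu ha hax hxb h1 h2 h3
    obtain ⟨m, hm, hmm⟩ := isCompact_Icc.exists_isMinOn (Set.nonempty_Icc.2 (hax.trans hxb).le)
      (f := fun t : ℝ => J (t • u)) (by fun_prop)
    have h4 : J (m • u) ≤ J (x • u) := hmm ⟨hax.le, hxb.le⟩
    have hma : a < m := by
      rcases hm.1.eq_or_lt with h | h
      · rw [← h] at h4; linarith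
      · exact h
    have hmb : m < b := by
      rcases hm.2.eq_or_lt with h | h
      · rw [h] at h4; linarith
      · exact h
    have := hNρ _ (hcrit u m hu (ha.trans_lt hma)
      ((hmm.isLocalMin (Icc_mem_nhds hma hmb)).hasDerivAt_eq_zero (hder u m)))
    linarith
  have hsmall : ∀ u : E, ‖u‖ < r → 0 ≤ J u := by
    intro u hur
    by_contra! hlt
    have hu : u ≠ 0 := by
      rintro rfl
      rw [hJ0] at hlt; exact lt_irrefl _ hlt
    have hup := norm_pos_iff.2 hu
    have := hray u hu
    refine hA u 0 1 (r / ‖u‖) hu le_rfl one_pos ((one_lt_div hup).2 hur) ?_ ?_ ?_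
    · rw [one_smul, zero_smul, hJ0]; exact hlt
    · rw [one_smul]; linarith
    · rw [one_smul]; linarith
  obtain ⟨δ, hδ0, hδr, hδ⟩ : ∃ δ : ℝ, 0 < δ ∧ δ ≤ r ∧ ∀ u : E, ‖u‖ < δ → J u < ρ := by
    have h1 : ∀ᶠ u in 𝓝 (0:E), J u < ρ :=
      (hJc.tendsto 0).eventually (gt_mem_nhds (by rw [hJ0]; exact hJ1))
    obtain ⟨δ, hδ, h⟩ := Metric.eventually_nhds_iff.1 h1
    refine ⟨min δ r, lt_min hδ hr, min_le_right _ _, fun u hu => h ?_⟩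
    rw [dist_zero_right]
    exact hu.trans_le (min_le_left _ _)
  have hd1 : ∀ u : E, HasDerivAt (fun t : ℝ => J (t • u)) (fderiv ℝ J u u) 1 := by
    intro u
    simpa using hder u 1
  have hgpos : ∀ u : E, u ≠ 0 → ‖u‖ < δ → 0 ≤ fderiv ℝ J u u := by
    intro u hu hud
    by_contra! hlt
    have hup := norm_pos_iff.2 hu
    have hb : 1 < r / ‖u‖ := (one_lt_div hup).2 (hud.trans_le hδr)
    obtain ⟨y, hy1, hy2, hy3⟩ := slope_right_aux _ _ 1 _ (hd1 u) hlt hb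
    have h1 := hδ u hud
    have h2 := hray u hu
    have h3 : J ((1:ℝ) • u) = J u := by rw [one_smul]
    refine hA u 1 y (r / ‖u‖) hu zero_le_one hy1 hy2 hy3 ?_ ?_ <;> linarith
  have hgneg : ∀ u : E, J u < 0 → fderiv ℝ J u u ≤ 0 := by
    intro u hlt
    by_contra! hpos
    have hu : u ≠ 0 := by
      rintro rfl
      rw [hJ0] at hlt; exact lt_irrefl _ hlt
    obtain ⟨y, hy1, hy2, hy3⟩ := slope_left_aux _ _ 1 0 (hd1 u) hpos one_pos
    have h3 : J ((1:ℝ) • u) = J u := by rw [one_smul]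
    have h4 : J ((0:ℝ) • u) = 0 := by rw [zero_smul, hJ0]
    refine hA u 0 y 1 hu le_rfl hy1 hy2 ?_ hy3 ?_ <;> linarith
  have hΓmem : ∀ γ, γ ∈ Γ ↔ ContinuousOn γ (Set.Icc 0 1) ∧ γ 0 = 0 ∧ J (γ 1) < 0 :=
    fun γ => by rw [hΓ]; rfl
  have hcross : ∀ γ ∈ Γ, ∃ s ∈ Set.Icc (0:ℝ) 1, γ s ∈ Neh := by
    intro γ hγ
    obtain ⟨hγc, hγ0, hγ1⟩ := (hΓmem γ).1 hγ
    have hγ1r : r ≤ ‖γ 1‖ := by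
      by_contra! hlt
      have := hsmall _ hlt
      linarith
    have hnc : ContinuousOn (fun s => ‖γ s‖) (Set.Icc 0 1) := hγc.norm
    have hK : IsCompact (Set.Icc (0:ℝ) 1 ∩ (fun s => ‖γ s‖) ⁻¹' Set.Iic (δ/2)) :=
      isCompact_Icc.of_isClosed_subset
        (hnc.preimage_isClosed_of_isClosed isClosed_Icc isClosed_Iic) Set.inter_subset_left
    obtain ⟨s0, ⟨hs0, hs0n⟩, hs0g⟩ := hK.exists_isGreatest
      ⟨0, ⟨le_rfl, zero_le_one⟩, by simp only [Set.mem_preimage, hγ0, norm_zero, Set.mem_Iic]; positivity⟩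
    have hsub : Set.Icc s0 1 ⊆ Set.Icc 0 1 := Set.Icc_subset_Icc_left hs0.1
    have hs0e : ‖γ s0‖ = δ / 2 := by
      obtain ⟨s, hs, hse⟩ := intermediate_value_Icc hs0.2 (hnc.mono hsub)
        (show δ / 2 ∈ Set.Icc ‖γ s0‖ ‖γ 1‖ from ⟨hs0n, by linarith⟩)
      have h1 : s ≤ s0 := hs0g ⟨hsub hs, hse.le⟩
      have h2 : s = s0 := le_antisymm h1 hs.1
      rw [← h2]; exact hse
    have hne : ∀ s ∈ Set.Icc s0 1, γ s ≠ 0 := by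
      intro s hs h0
      have h1 : s ≤ s0 := hs0g ⟨hsub hs, by
        simp only [Set.mem_preimage, h0, norm_zero, Set.mem_Iic]; positivity⟩
      have h2 : s = s0 := le_antisymm h1 hs.1
      rw [← h2, h0, norm_zero] at hs0e
      linarith
    have hgc : ContinuousOn (fun s => fderiv ℝ J (γ s) (γ s)) (Set.Icc s0 1) :=
      ((hJ.continuous_fderiv (by norm_num)).comp_continuousOn (hγc.mono hsub)).clm_apply
        (hγc.mono hsub)
    obtain ⟨s, hs, hse⟩ := intermediate_value_Icc' hs0.2 hgc
      (show (0:ℝ) ∈ Set.Icc _ _ from ⟨hgneg _ hγ1,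
        hgpos _ (hne s0 ⟨le_rfl, hs0.2⟩) (by linarith)⟩)
    exact ⟨s, hsub hs, (hNmem _).2 ⟨hne s hs, hse⟩⟩
  -- sets and their bounds
  have hsup : ∀ γ : ℝ → E, {b : ℝ | ∃ t ∈ Set.Icc (0:ℝ) 1, b = J (γ t)} =
      (fun t => J (γ t)) '' Set.Icc (0:ℝ) 1 := by
    intro γ
    ext b
    constructor
    · rintro ⟨t, ht, rfl⟩; exact ⟨t, ht, rfl⟩
    · rintro ⟨t, ht, rfl⟩; exact ⟨t, ht, rfl⟩
  have hbddγ : ∀ γ ∈ Γ, BddAbove {b : ℝ | ∃ t ∈ Set.Icc (0:ℝ) 1, b = J (γ t)} := by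
    intro γ hγ
    rw [hsup]
    exact (isCompact_Icc.image_of_continuousOn
      (hJc.comp_continuousOn ((hΓmem γ).1 hγ).1)).bddAbove
  have hpath : ∀ u ∈ Neh, ∃ γ ∈ Γ, sSup {b : ℝ | ∃ t ∈ Set.Icc (0:ℝ) 1, b = J (γ t)} ≤ J u := by
    intro u hu
    obtain ⟨T, hT0, hT⟩ := hneg u ((hNmem u).1 hu).1
    refine ⟨fun t => (t * T) • u, (hΓmem _).2 ⟨by fun_prop, by simp, by simpa using hT T le_rfl⟩, ?_⟩
    refine csSup_le ⟨_, 0, ⟨le_rfl, zero_le_one⟩, rfl⟩ ?_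
    rintro _ ⟨t, ht, rfl⟩
    exact hN2 u hu _ (mul_nonneg ht.1 hT0.le)
  have hNne : Neh.Nonempty := by
    obtain ⟨t, -, ht⟩ := hmax u₀ hu₀0
    exact ⟨_, ht⟩
  have hΓne : Γ.Nonempty := by
    obtain ⟨u, hu⟩ := hNne
    obtain ⟨γ, hγ, -⟩ := hpath u hu
    exact ⟨γ, hγ⟩
  have hsets : {a : ℝ | ∃ u ∈ Neh, a = J u} =
      {a : ℝ | ∃ u : E, u ≠ 0 ∧ a = sSup {b : ℝ | ∃ t : ℝ, 0 ≤ t ∧ b = J (t • u)}} := by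
    have hval : ∀ (u : E) (t : ℝ), 0 < t → t • u ∈ Neh →
        sSup {b : ℝ | ∃ t : ℝ, 0 ≤ t ∧ b = J (t • u)} = J (t • u) := by
      intro u t ht hu
      refine IsGreatest.csSup_eq ⟨⟨t, ht.le, rfl⟩, ?_⟩
      rintro _ ⟨s, hs, rfl⟩
      have := hN2 _ hu (s / t) (by positivity)
      rwa [smul_smul, div_mul_cancel₀ _ ht.ne'] at this
    ext a
    constructor
    · rintro ⟨u, hu, rfl⟩
      refine ⟨u, ((hNmem u).1 hu).1, ?_⟩
      rw [hval u 1 one_pos (by rwa [one_smul]), one_smul]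
    · rintro ⟨u, hu, rfl⟩
      obtain ⟨t, ht, htN⟩ := hmax u hu
      exact ⟨_, htN, hval u t ht htN⟩
  set c := sInf {a : ℝ | ∃ γ ∈ Γ, a = sSup {b : ℝ | ∃ t ∈ Set.Icc (0:ℝ) 1, b = J (γ t)}} with hc
  have hsupN : ∀ γ ∈ Γ, ∃ u ∈ Neh, J u ≤ sSup {b : ℝ | ∃ t ∈ Set.Icc (0:ℝ) 1, b = J (γ t)} := by
    intro γ hγ
    obtain ⟨s, hs, hsN⟩ := hcross γ hγ
    exact ⟨_, hsN, le_csSup (hbddγ γ hγ) ⟨s, hs, rfl⟩⟩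
  have hcbdd : BddBelow {a : ℝ | ∃ γ ∈ Γ, a = sSup {b : ℝ | ∃ t ∈ Set.Icc (0:ℝ) 1, b = J (γ t)}} := by
    refine ⟨ρ, ?_⟩
    rintro _ ⟨γ, hγ, rfl⟩
    obtain ⟨u, hu, h⟩ := hsupN γ hγ
    exact (hNρ u hu).trans h
  have hcne : {a : ℝ | ∃ γ ∈ Γ, a = sSup {b : ℝ | ∃ t ∈ Set.Icc (0:ℝ) 1, b = J (γ t)}}.Nonempty := by
    obtain ⟨γ, hγ⟩ := hΓne
    exact ⟨_, γ, hγ, rfl⟩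
  have hNbdd : BddBelow {a : ℝ | ∃ u ∈ Neh, a = J u} := by
    refine ⟨ρ, ?_⟩
    rintro _ ⟨u, hu, rfl⟩
    exact hNρ u hu
  have hρc : ρ ≤ c := by
    refine le_csInf hcne ?_
    rintro _ ⟨γ, hγ, rfl⟩
    obtain ⟨u, hu, h⟩ := hsupN γ hγ
    exact (hNρ u hu).trans h
  have hcN : c = sInf {a : ℝ | ∃ u ∈ Neh, a = J u} := by
    apply le_antisymm
    · refine le_csInf ?_ ?_
      · obtain ⟨u, hu⟩ := hNne
        exact ⟨_, u, hu, rfl⟩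
      · rintro _ ⟨u, hu, rfl⟩
        obtain ⟨γ, hγ, h⟩ := hpath u hu
        exact (csInf_le hcbdd ⟨γ, hγ, rfl⟩).trans h
    · refine le_csInf hcne ?_
      rintro _ ⟨γ, hγ, rfl⟩
      obtain ⟨u, hu, h⟩ := hsupN γ hγ
      exact (csInf_le hNbdd ⟨u, hu, rfl⟩).trans h
  refine ⟨hΓne, hNne, ⟨hJ1, hρc⟩, hcN, by rw [← hsets]; exact hcN, ?_⟩
  have hcp : 0 < c := hJ1.trans_le hρc
  have hiSup : ∀ γ : ℝ → E, sSup {b : ℝ | ∃ t ∈ Set.Icc (0:ℝ) 1, b = J (γ t)} =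
      ⨆ s : unitInterval, J (γ s) := by
    intro γ
    rw [hsup, sSup_image']
  have hcer : ∀ n : ℕ, ∃ u, c ≤ J u ∧ J u ≤ c + 1 / ((n:ℝ) + 1) ∧
      (1 + ‖u‖) * ‖fderiv ℝ J u‖ ≤ 2 * (1 / ((n:ℝ) + 1)) := by
    intro n
    have hε : (0:ℝ) < 1 / ((n:ℝ) + 1) := by positivity
    obtain ⟨_, ⟨γ, hγ, rfl⟩, hlt⟩ := exists_lt_of_csInf_lt hcne
      (show c < c + 1 / ((n:ℝ) + 1) by linarith)
    obtain ⟨hγc, hγ0, hγ1⟩ := (hΓmem γ).1 hγ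
    refine cerami_aux J hJ (γ 1) hJ0.le hγ1.le c hcp ?_ _ hε
      ⟨fun s : unitInterval => γ s, continuousOn_iff_continuous_restrict.1 hγc⟩ hγ0 rfl ?_
    · intro η hη0 hη1
      have hmem : Set.IccExtend (zero_le_one (α := ℝ)) η ∈ Γ := by
        rw [hΓmem]
        refine ⟨(η.continuous.Icc_extend').continuousOn, ?_, ?_⟩
        · rw [Set.IccExtend_left]; exact hη0
        · rw [Set.IccExtend_right]
          exact lt_of_eq_of_lt (congrArg J hη1) hγ1
      have h1 := csInf_le hcbdd ⟨_, hmem, rfl⟩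
      rw [hiSup] at h1
      simpa only [Set.IccExtend_val] using h1
    · rw [hiSup] at hlt
      exact hlt.le
  choose un h1 h2 h3 using hcer
  have hz : Tendsto (fun n : ℕ => 1 / ((n:ℝ) + 1)) atTop (𝓝 0) :=
    tendsto_one_div_add_atTop_nhds_zero_nat
  refine ⟨un, ?_, ?_⟩
  · refine tendsto_of_tendsto_of_tendsto_of_le_of_le tendsto_const_nhds ?_ h1 h2
    simpa using hz.const_add c
  · refine squeeze_zero (fun n => by positivity) h3 ?_
    simpa using hz.const_mul 2
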